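/- Let T = (V,E) be a finite rooted tree with n vertices, let 𝓗 be a Polish metric space of diameter at most 1, let b ∈ [0,1), and let ν be a b-Lipschitz 𝓗-valued Markov measure indexed by T. Then for every function f : 𝓗^V → ℝ that is 1-Lipschitz with respect to the normalized Hamming metric and satisfies ∫ f dν = 0, and every λ ∈ ℝ, one has ∫ e^{nλf} dν ≤ e^{λ²Δ²/8}, where Δ is the ℓ² norm of the descendant generating function of T with parameter b. -/

import Mathlib

open MeasureTheory ProbabilityTheory Filter Topology
open scoped ENNReal NNReal

/-- A rooted tree on vertex type `V`, encoded by its root and parent function: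
every vertex reaches the root by iterating `parent`, and the root is a fixed
point of `parent`. -/
structure ParentTree (V : Type*) where
  root : V
  parent : V → V
  parent_root : parent root = root
  reaches_root : ∀ v : V, ∃ n : ℕ, parent^[n] v = root

namespace ParentTree

variable {V : Type*} (T : ParentTree V)

/-- The depth of a vertex: its graph distance to the root. -/
noncomputable def depth (v : V) : ℕ := sInf {n : ℕ | T.parent^[n] v = T.root}

lemma depth_spec (v : V) : T.parent^[T.depth v] v = T.root :=
  Nat.sInf_mem (T.reaches_root v)

lemma depth_root : T.depth T.root = 0 :=
  Nat.eq_zero_of_le_zero (Nat.sInf_le (by simp))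

lemma depth_parent_le (v : V) : T.depth (T.parent v) ≤ T.depth v := by
  have hspec := T.depth_spec v
  cases h : T.depth v with
  | zero =>
      rw [h] at hspec
      simp only [Function.iterate_zero, id_eq] at hspec
      subst hspec
      simp [T.parent_root, T.depth_root]
  | succ m =>
      rw [h, Function.iterate_succ_apply] at hspec
      exact (Nat.sInf_le hspec).trans (Nat.le_succ m)

/-- `Desc T r v` is the set of descendants of `v` exactly `r` generations below `v`. -/
def Desc (r : ℕ) (v : V) : Set V :=
  {w : V | T.parent^[r] w = v ∧ T.depth w = T.depth v + r}

/-- The set of children of a vertex. -/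
def children (v : V) : Set V := {w : V | w ≠ T.root ∧ T.parent w = v}

/-- The graph distance between two vertices of the tree. -/
noncomputable def tdist (v w : V) : ℕ :=
  sInf {k : ℕ | ∃ n m : ℕ, n + m = k ∧ T.parent^[n] v = T.parent^[m] w}

/-- The descendant generating function `δ(v) = ∑_r |D_r(v)| bʳ`. -/
noncomputable def dgf (b : ℝ) (v : V) : ℝ :=
  ∑' r : ℕ, (Nat.card (T.Desc r v) : ℝ) * b ^ r

/-- `Δ = ‖δ‖_{ℓ²(V)}` for a finite tree. -/
noncomputable def Delta [Fintype V] (b : ℝ) : ℝ :=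
  Real.sqrt (∑ v : V, T.dgf b v ^ 2)

/-- Upper growth rate `limsup_r |D_r(ρ)|^{1/r}`. -/
noncomputable def bargr : ℝ≥0∞ :=
  Filter.atTop.limsup fun r : ℕ => (Nat.card (T.Desc r T.root) : ℝ≥0∞) ^ (1 / (r : ℝ))

/-- Maximum local growth rate `limsup_r max_v |D_r(v)|^{1/r}`. -/
noncomputable def maxgr : ℝ≥0∞ :=
  Filter.atTop.limsup fun r : ℕ => ⨆ v : V, (Nat.card (T.Desc r v) : ℝ≥0∞) ^ (1 / (r : ℝ))

/-- The parent map of the depth-`k` truncation. -/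
noncomputable def truncParent (k : ℕ) (v : {v : V // T.depth v ≤ k}) :
    {v : V // T.depth v ≤ k} :=
  ⟨T.parent v.1, le_trans (T.depth_parent_le v.1) v.2⟩

lemma truncParent_iterate (k n : ℕ) (v : {v : V // T.depth v ≤ k}) :
    ((T.truncParent k)^[n] v).1 = T.parent^[n] v.1 := by
  induction n generalizing v with
  | zero => rfl
  | succ n ih =>
      rw [Function.iterate_succ_apply, Function.iterate_succ_apply]
      exact ih _

/-- The subtree induced by the vertices within distance `k` of the root. -/
noncomputable def trunc (k : ℕ) : ParentTree {v : V // T.depth v ≤ k} where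
  root := ⟨T.root, by simp [T.depth_root]⟩
  parent := T.truncParent k
  parent_root := Subtype.ext T.parent_root
  reaches_root := fun v => by
    obtain ⟨n, hn⟩ := T.reaches_root v.1
    exact ⟨n, Subtype.ext (by rw [truncParent_iterate, hn])⟩

end ParentTree
/-- The transportation cost between two measures relative to a cost function `c`:
the infimum over couplings `γ` of `∫ c dγ`. -/
noncomputable def transportCost {X : Type*} [MeasurableSpace X] (c : X → X → ℝ)
    (μ ν : MeasureTheory.Measure X) : ℝ :=
  sInf {r : ℝ | ∃ γ : MeasureTheory.Measure (X × X),
    γ.map Prod.fst = μ ∧ γ.map Prod.snd = ν ∧ r = ∫ q, c q.1 q.2 ∂γ}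

/-- The normalized Hamming distance on `V → H` induced by the metric of `H`. -/
noncomputable def nhdist {V H : Type*} [Fintype V] [PseudoMetricSpace H] (x y : V → H) : ℝ :=
  (Fintype.card V : ℝ)⁻¹ * ∑ v, dist (x v) (y v)

namespace ParentTree

open Classical in
/-- The broadcast (Markov) measure built up level by level: at step `k+1` all the
coordinates at depth `k+1` are sampled, conditionally independently, from the kernels
applied to the values at their parents. -/
noncomputable def levelMeasure {V : Type*} [Fintype V] (T : ParentTree V)
    {H : Type*} [MeasurableSpace H] (m : MeasureTheory.Measure H)
    (q : V → ProbabilityTheory.Kernel H H) : ℕ → MeasureTheory.Measure (V → H)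
  | 0 => m.map (fun h _ => h)
  | (k+1) => (T.levelMeasure m q k).bind fun x =>
      MeasureTheory.Measure.pi fun v =>
        if T.depth v = k + 1 then (q v) (x (T.parent v)) else MeasureTheory.Measure.dirac (x v)

/-- `ν` is a `b`-Lipschitz `H`-valued Markov measure indexed by `T`: it is the broadcast
model of some root distribution and some Markov kernels, each non-root kernel being
`b`-Lipschitz from `H` to the space of measures with the transportation metric. -/
def IsLipMarkov {V : Type*} [Fintype V] (T : ParentTree V)
    {H : Type*} [MeasurableSpace H] [PseudoMetricSpace H] (b : ℝ)
    (ν : MeasureTheory.Measure (V → H)) : Prop :=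
  ∃ (m : MeasureTheory.Measure H) (q : V → ProbabilityTheory.Kernel H H),
    MeasureTheory.IsProbabilityMeasure m ∧ (∀ v, ProbabilityTheory.IsMarkovKernel (q v)) ∧
    (∀ v, v ≠ T.root → ∀ x y : H, transportCost dist ((q v) x) ((q v) y) ≤ b * dist x y) ∧
    ν = T.levelMeasure m q (Fintype.card V)

end ParentTree

section BoundedDifferences

variable {ι H : Type*} [Fintype ι] [MetricSpace H]

/-- `g` is Lipschitz for the Hamming metric with weight `c i` on the coordinate `i`. -/
def WeightedLip (c : ι → ℝ) (g : (ι → H) → ℝ) : Prop :=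
  ∀ x y, |g x - g y| ≤ ∑ i, c i * dist (x i) (y i)

namespace WeightedLip

variable {c : ι → ℝ} {g : (ι → H) → ℝ}

lemma continuous (hg : WeightedLip c g) : Continuous g := by
  refine continuous_iff_continuousAt.2 fun x => tendsto_iff_dist_tendsto_zero.2 ?_
  have h : Tendsto (fun y : ι → H => ∑ i, c i * dist (y i) (x i)) (𝓝 x) (𝓝 0) := by
    have : Continuous fun y : ι → H => ∑ i, c i * dist (y i) (x i) := by fun_prop
    simpa using this.tendsto x
  exact squeeze_zero (fun _ => dist_nonneg) (fun y => hg y x) h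

lemma exists_bound (hH : ∀ a b : H, dist a b ≤ 1) (hg : WeightedLip c g) :
    ∃ C, ∀ x, |g x| ≤ C := by
  rcases isEmpty_or_nonempty (ι → H) with h | ⟨⟨x₀⟩⟩
  · exact ⟨0, fun x => (h.false x).elim⟩
  · refine ⟨∑ i, |c i| + |g x₀|, fun x => ?_⟩
    have h1 : |g x - g x₀| ≤ ∑ i, |c i| := (hg x x₀).trans <| Finset.sum_le_sum fun i _ =>
      (mul_le_mul_of_nonneg_right (le_abs_self _) dist_nonneg).trans
        (mul_le_of_le_one_right (abs_nonneg _) (hH _ _))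
    have h2 := abs_add_le (g x - g x₀) (g x₀)
    rw [sub_add_cancel] at h2
    linarith

variable [TopologicalSpace.SeparableSpace H] [MeasurableSpace H] [BorelSpace H]

lemma measurable (hg : WeightedLip c g) : Measurable g := by
  have := UniformSpace.secondCountable_of_separable H
  exact hg.continuous.measurable

lemma integrable (hH : ∀ a b : H, dist a b ≤ 1) (hg : WeightedLip c g)
    {Ω : Type*} [MeasurableSpace Ω] (μ : Measure Ω) [IsFiniteMeasure μ]
    {X : Ω → ι → H} (hX : Measurable X) : Integrable (fun ω => g (X ω)) μ := by
  obtain ⟨C, hC⟩ := hg.exists_bound hH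
  exact .of_bound (hg.measurable.comp hX).aestronglyMeasurable C (ae_of_all _ fun ω => hC _)

lemma integrable_exp (hH : ∀ a b : H, dist a b ≤ 1) (hg : WeightedLip c g) (t : ℝ)
    {Ω : Type*} [MeasurableSpace Ω] (μ : Measure Ω) [IsFiniteMeasure μ]
    {X : Ω → ι → H} (hX : Measurable X) : Integrable (fun ω => Real.exp (t * g (X ω))) μ := by
  obtain ⟨C, hC⟩ := hg.exists_bound hH
  refine .of_bound ((hg.measurable.comp hX).const_mul t).exp.aestronglyMeasurable
    (Real.exp (|t| * C)) (ae_of_all _ fun ω => ?_)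
  rw [Real.norm_eq_abs, Real.abs_exp, Real.exp_le_exp]
  refine (le_abs_self _).trans ?_
  rw [abs_mul]
  exact mul_le_mul_of_nonneg_left (hC _) (abs_nonneg _)

end WeightedLip

/-- Hoeffding's lemma for a function whose oscillation is at most `c`. -/
lemma integral_exp_le_of_abs_sub_le {Ω : Type*} [MeasurableSpace Ω] (μ : Measure Ω)
    [IsProbabilityMeasure μ] {X : Ω → ℝ} (hX : Measurable X) {c : ℝ}
    (hc : ∀ a b, |X a - X b| ≤ c) (t : ℝ) :
    ∫ ω, Real.exp (t * X ω) ∂μ ≤ Real.exp (t * ∫ ω, X ω ∂μ + t ^ 2 * c ^ 2 / 8) := by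
  obtain ⟨ω₀⟩ := μ.nonempty_of_neZero
  have hne : Nonempty Ω := ⟨ω₀⟩
  have hbdd : BddBelow (Set.range X) := ⟨X ω₀ - c, by
    rintro _ ⟨a, rfl⟩
    linarith [(abs_le.1 (hc ω₀ a)).2]⟩
  have hmem : ∀ ω, X ω ∈ Set.Icc (⨅ a, X a) ((⨅ a, X a) + c) := fun ω =>
    ⟨ciInf_le hbdd ω, by
      rw [← sub_le_iff_le_add]
      exact le_ciInf fun a => by linarith [(abs_le.1 (hc ω a)).2]⟩
  have h := (hasSubgaussianMGF_of_mem_Icc (μ := μ) hX.aemeasurable (ae_of_all _ hmem)).mgf_le t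
  rw [mgf, add_sub_cancel_left] at h
  have hsplit : ∀ ω, Real.exp (t * X ω) =
      Real.exp (t * ∫ ω, X ω ∂μ) * Real.exp (t * (X ω - ∫ ω, X ω ∂μ)) := fun ω => by
    rw [← Real.exp_add]; congr 1; ring
  simp_rw [hsplit]
  rw [integral_const_mul, Real.exp_add]
  refine mul_le_mul_of_nonneg_left (h.trans (le_of_eq ?_)) (Real.exp_nonneg _)
  congr 1
  push_cast
  rw [Real.norm_eq_abs, div_pow, sq_abs]
  ring

lemma exists_coupling_of_transportCost_le [MeasurableSpace H] (μ ν : Measure H) [IsProbabilityMeasure μ]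
    [IsProbabilityMeasure ν] {r ε : ℝ} (h : transportCost dist μ ν ≤ r) (hε : 0 < ε) :
    ∃ γ : Measure (H × H), IsProbabilityMeasure γ ∧ γ.map Prod.fst = μ ∧ γ.map Prod.snd = ν ∧
      ∫ p, dist p.1 p.2 ∂γ ≤ r + ε := by
  have hlt : transportCost dist μ ν < r + ε := by linarith
  rw [transportCost] at hlt
  obtain ⟨_, ⟨γ, h₁, h₂, rfl⟩, hγ⟩ := exists_lt_of_csInf_lt
    (by exact ⟨_, μ.prod ν, by simp, by simp, rfl⟩) hlt
  refine ⟨γ, ⟨?_⟩, h₁, h₂, hγ.le⟩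
  rw [← Set.preimage_univ (f := Prod.fst), ← Measure.map_apply measurable_fst .univ, h₁,
    measure_univ]

variable [TopologicalSpace.SeparableSpace H] [MeasurableSpace H] [BorelSpace H]

lemma integral_exp_pi_fin_le (hH : ∀ a b : H, dist a b ≤ 1) (t : ℝ) (n : ℕ)
    (μ : Fin n → Measure H) [∀ i, IsProbabilityMeasure (μ i)] {c : Fin n → ℝ} (hc : ∀ i, 0 ≤ c i)
    {g : (Fin n → H) → ℝ} (hg : WeightedLip c g) :
    ∫ x, Real.exp (t * g x) ∂Measure.pi μ ≤
      Real.exp (t * ∫ x, g x ∂Measure.pi μ + t ^ 2 * (∑ i, c i ^ 2) / 8) := by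
  induction n with
  | zero =>
    have h : ∀ x, g x = g default := fun x => congrArg g (Subsingleton.elim _ _)
    simp only [h]
    simp
  | succ n ih =>
    have hmp := (measurePreserving_piFinSuccAbove μ 0).symm
    have hcons : Measurable fun p : H × (Fin n → H) =>
        (MeasurableEquiv.piFinSuccAbove (fun _ => H) 0).symm p := MeasurableEquiv.measurable _
    have hev : ∀ p : H × (Fin n → H), (MeasurableEquiv.piFinSuccAbove (fun _ => H) 0).symm p =
        Fin.cons p.1 p.2 := fun p => by
      simp [MeasurableEquiv.piFinSuccAbove, Fin.insertNthEquiv]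
    simp_rw [hev] at hcons
    have key : ∀ F : (Fin (n + 1) → H) → ℝ,
        Integrable (fun p : H × (Fin n → H) => F (Fin.cons p.1 p.2))
          ((μ 0).prod (Measure.pi fun i : Fin n => μ i.succ)) →
        ∫ x, F x ∂Measure.pi μ =
          ∫ y, ∫ h, F (Fin.cons h y) ∂μ 0 ∂Measure.pi fun i : Fin n => μ i.succ := fun F hF => by
      rw [← hmp.integral_comp (MeasurableEquiv.measurableEmbedding _)]
      simp_rw [hev]
      exact integral_prod_symm _ hF
    rw [key _ (hg.integrable_exp hH t _ hcons), key _ (hg.integrable hH _ hcons)]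
    set G : (Fin n → H) → ℝ := fun y => ∫ h, g (Fin.cons h y) ∂μ 0 with hG
    have hslice : ∀ y : Fin n → H, Measurable fun h : H => (Fin.cons h y : Fin (n + 1) → H) :=
      fun y => hcons.comp (measurable_id.prodMk measurable_const)
    have hGlip : WeightedLip (fun i : Fin n => c i.succ) G := fun y y' => by
      rw [hG]
      dsimp only
      rw [← integral_sub (hg.integrable hH _ (hslice y)) (hg.integrable hH _ (hslice y'))]
      have hpt : ∀ h : H, ‖g (Fin.cons h y) - g (Fin.cons h y')‖ ≤
          ∑ i : Fin n, c i.succ * dist (y i) (y' i) := fun h => by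
        simpa [Fin.sum_univ_succ] using hg (Fin.cons h y) (Fin.cons h y')
      simpa using norm_integral_le_of_norm_le_const (μ := μ 0) (ae_of_all _ hpt)
    have hinner : ∀ y, ∫ h, Real.exp (t * g (Fin.cons h y)) ∂μ 0 ≤
        Real.exp (t ^ 2 * c 0 ^ 2 / 8) * Real.exp (t * G y) := fun y => by
      rw [← Real.exp_add, add_comm (t ^ 2 * c 0 ^ 2 / 8)]
      refine integral_exp_le_of_abs_sub_le (μ 0) (hg.measurable.comp (hslice y)) (fun a b => ?_) t
      refine (hg _ _).trans ?_
      simpa [Fin.sum_univ_succ] using mul_le_of_le_one_right (hc 0) (hH a b)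
    calc _ ≤ ∫ y, Real.exp (t ^ 2 * c 0 ^ 2 / 8) * Real.exp (t * G y)
            ∂Measure.pi fun i : Fin n => μ i.succ :=
          integral_mono_of_nonneg (ae_of_all _ fun y => integral_nonneg fun h => Real.exp_nonneg _)
            ((hGlip.integrable_exp hH t _ measurable_id).const_mul _) (ae_of_all _ hinner)
      _ ≤ _ := by
        rw [integral_const_mul]
        refine (mul_le_mul_of_nonneg_left (ih _ (fun i => hc i.succ) hGlip)
          (Real.exp_nonneg _)).trans (le_of_eq ?_)
        rw [← Real.exp_add, Fin.sum_univ_succ]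
        congr 1
        ring

/-- The bounded differences inequality for product measures. -/
lemma integral_exp_pi_le (hH : ∀ a b : H, dist a b ≤ 1) (t : ℝ)
    (μ : ι → Measure H) [∀ i, IsProbabilityMeasure (μ i)] {c : ι → ℝ} (hc : ∀ i, 0 ≤ c i)
    {g : (ι → H) → ℝ} (hg : WeightedLip c g) :
    ∫ x, Real.exp (t * g x) ∂Measure.pi μ ≤
      Real.exp (t * ∫ x, g x ∂Measure.pi μ + t ^ 2 * (∑ i, c i ^ 2) / 8) := by
  let e := (Fintype.equivFin ι).symm
  have hmp := measurePreserving_piCongrLeft μ e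
  have hev : ∀ y : Fin (Fintype.card ι) → H,
      MeasurableEquiv.piCongrLeft (fun _ : ι => H) e y = fun i => y (e.symm i) := fun y => by
    ext i
    obtain ⟨j, rfl⟩ := e.surjective i
    simpa using MeasurableEquiv.piCongrLeft_apply_apply (β := fun _ : ι => H) e y j
  rw [← hmp.integral_comp (MeasurableEquiv.measurableEmbedding _),
    ← hmp.integral_comp (MeasurableEquiv.measurableEmbedding _), ← e.sum_comp]
  simp_rw [hev]
  refine integral_exp_pi_fin_le hH t _ (fun i => μ (e i)) (fun i => hc (e i)) fun x y => ?_
  refine (hg _ _).trans (le_of_eq ?_)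
  rw [← e.sum_comp]
  simp

lemma integrable_dist (hH : ∀ a b : H, dist a b ≤ 1) (γ : Measure (H × H)) [IsFiniteMeasure γ] :
    Integrable (fun p : H × H => dist p.1 p.2) γ := by
  have := UniformSpace.secondCountable_of_separable H
  refine .of_bound (by fun_prop) 1 (ae_of_all _ fun p => ?_)
  rw [Real.norm_eq_abs, abs_of_nonneg dist_nonneg]
  exact hH _ _

/-- Integrals of a weighted Lipschitz function against two product measures, compared through
couplings of their factors. -/
lemma abs_integral_pi_sub_le_of_coupling (hH : ∀ a b : H, dist a b ≤ 1)
    (μ ν : ι → Measure H) [∀ i, IsProbabilityMeasure (μ i)] [∀ i, IsProbabilityMeasure (ν i)]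
    {c : ι → ℝ} {g : (ι → H) → ℝ} (hg : WeightedLip c g) (hc : ∀ i, 0 ≤ c i)
    (γ : ι → Measure (H × H)) [∀ i, IsProbabilityMeasure (γ i)]
    (h₁ : ∀ i, (γ i).map Prod.fst = μ i) (h₂ : ∀ i, (γ i).map Prod.snd = ν i)
    {r : ι → ℝ} (hr : ∀ i, ∫ p, dist p.1 p.2 ∂γ i ≤ r i) :
    |∫ x, g x ∂Measure.pi μ - ∫ x, g x ∂Measure.pi ν| ≤ ∑ i, c i * r i := by
  obtain rfl : (fun i => (γ i).map Prod.fst) = μ := funext h₁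
  obtain rfl : (fun i => (γ i).map Prod.snd) = ν := funext h₂
  have := UniformSpace.secondCountable_of_separable H
  have hfst : Measurable fun (z : ι → H × H) i => (z i).1 := by fun_prop
  have hsnd : Measurable fun (z : ι → H × H) i => (z i).2 := by fun_prop
  have hi : ∀ i, Integrable (fun z : ι → H × H => c i * dist (z i).1 (z i).2) (Measure.pi γ) :=
    fun i => (((measurePreserving_eval γ i).integrable_comp
      (integrable_dist hH (γ i)).aestronglyMeasurable).2 (integrable_dist hH (γ i))).const_mul _
  rw [← Measure.pi_map_pi (fun i => measurable_fst.aemeasurable),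
    ← Measure.pi_map_pi (fun i => measurable_snd.aemeasurable),
    integral_map hfst.aemeasurable hg.measurable.aestronglyMeasurable,
    integral_map hsnd.aemeasurable hg.measurable.aestronglyMeasurable,
    ← integral_sub (hg.integrable hH _ hfst) (hg.integrable hH _ hsnd)]
  calc _ ≤ ∫ z, |g (fun i => (z i).1) - g (fun i => (z i).2)| ∂Measure.pi γ :=
        abs_integral_le_integral_abs
    _ ≤ ∫ z, ∑ i, c i * dist (z i).1 (z i).2 ∂Measure.pi γ :=
        integral_mono_of_nonneg (ae_of_all _ fun _ => abs_nonneg _)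
          (integrable_finsetSum _ fun i _ => hi i) (ae_of_all _ fun z => hg _ _)
    _ = ∑ i, c i * ∫ p, dist p.1 p.2 ∂γ i := by
        rw [integral_finsetSum _ fun i _ => hi i]
        refine Finset.sum_congr rfl fun i _ => ?_
        rw [integral_const_mul, integral_comp_eval (X := fun _ => H × H) (i := i) (f := fun p : H × H => dist p.1 p.2)
          (integrable_dist hH (γ i)).aestronglyMeasurable]
    _ ≤ _ := Finset.sum_le_sum fun i _ => mul_le_mul_of_nonneg_left (hr i) (hc i)

/-- Freezing the coordinates outside `s` in a product measure does not cost anything in the bounded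
differences inequality. -/
lemma integral_exp_pi_le_of_dirac (hH : ∀ a b : H, dist a b ≤ 1) (t : ℝ)
    (s : ι → Prop) [DecidablePred s] (μ : ι → Measure H) [∀ i, IsProbabilityMeasure (μ i)]
    (x₀ : ι → H) (hμ : ∀ i, ¬ s i → μ i = Measure.dirac (x₀ i)) {c : ι → ℝ} (hc : ∀ i, 0 ≤ c i)
    {g : (ι → H) → ℝ} (hg : WeightedLip c g) :
    ∫ x, Real.exp (t * g x) ∂Measure.pi μ ≤
      Real.exp (t * ∫ x, g x ∂Measure.pi μ + t ^ 2 * (∑ i, if s i then c i ^ 2 else 0) / 8) := by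
  let φ : ∀ _ : ι, H → H := fun i h => if s i then h else x₀ i
  have hφ : ∀ i, Measurable (φ i) := fun i => by
    by_cases h : s i
    · simpa [φ, h] using measurable_id'
    · simp [φ, h]
  have hΦ : Measurable fun (x : ι → H) i => φ i (x i) :=
    measurable_pi_lambda _ fun i => (hφ i).comp (measurable_pi_apply i)
  have hmap : ∀ i, (μ i).map (φ i) = μ i := fun i => by
    by_cases h : s i
    · simp [φ, h]
    · simp [φ, h, hμ i h]
  have hprob : ∀ i, IsProbabilityMeasure ((μ i).map (φ i)) := fun i => by
    rw [hmap i]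
    infer_instance
  have hpi : (Measure.pi μ).map (fun x i => φ i (x i)) = Measure.pi μ := by
    rw [Measure.pi_map_pi fun i => (hφ i).aemeasurable]
    exact congrArg Measure.pi (funext hmap)
  have hlip : WeightedLip (fun i => if s i then c i else 0) fun x => g fun i => φ i (x i) :=
    fun x y => (hg _ _).trans <| Finset.sum_le_sum fun i _ => by
      by_cases h : s i <;> simp [φ, h]
  have h := integral_exp_pi_le hH t μ (fun i => by split_ifs <;> simp [hc]) hlip
  have hsq : ∀ i, (if s i then c i else 0) ^ 2 = if s i then c i ^ 2 else 0 := fun i => by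
    split_ifs <;> simp
  simp only [hsq] at h
  rwa [← integral_map (f := fun x => Real.exp (t * g x)) hΦ.aemeasurable
      (hg.measurable.const_mul t).exp.aestronglyMeasurable,
    ← integral_map hΦ.aemeasurable hg.measurable.aestronglyMeasurable, hpi] at h

end BoundedDifferences

namespace ParentTree

section Combinatorics

variable {V : Type*} (T : ParentTree V)

lemma depth_eq_zero_iff {v : V} : T.depth v = 0 ↔ v = T.root := by
  refine ⟨fun h => ?_, fun h => h ▸ T.depth_root⟩
  simpa [h] using T.depth_spec v

lemma depth_le_depth_parent_add_one (v : V) : T.depth v ≤ T.depth (T.parent v) + 1 :=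
  Nat.sInf_le (by
    rw [Set.mem_ofPred_eq, Function.iterate_succ_apply]
    exact T.depth_spec _)

lemma depth_eq_depth_parent_add_one {v : V} (hv : v ≠ T.root) :
    T.depth v = T.depth (T.parent v) + 1 := by
  refine le_antisymm (T.depth_le_depth_parent_add_one v) ?_
  obtain ⟨m, hm⟩ := Nat.exists_eq_succ_of_ne_zero (mt T.depth_eq_zero_iff.1 hv)
  have h := T.depth_spec v
  rw [hm, Function.iterate_succ_apply] at h
  rw [hm]
  exact Nat.succ_le_succ (Nat.sInf_le h)

lemma depth_le_depth_iterate_add (r : ℕ) (v : V) : T.depth v ≤ T.depth (T.parent^[r] v) + r := by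
  induction r generalizing v with
  | zero => simp
  | succ r ih =>
    rw [Function.iterate_succ_apply]
    have := ih (T.parent v)
    have := T.depth_le_depth_parent_add_one v
    omega

lemma depth_iterate {r : ℕ} {v : V} (hr : r ≤ T.depth v) :
    T.depth (T.parent^[r] v) = T.depth v - r := by
  induction r with
  | zero => simp
  | succ r ih =>
    have ih := ih (by omega)
    rw [Function.iterate_succ_apply']
    have := T.depth_eq_depth_parent_add_one (v := T.parent^[r] v) fun h => by
      rw [h, T.depth_root] at ih
      omega
    omega

lemma Desc_zero (v : V) : T.Desc 0 v = {v} := by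
  ext w
  simp only [Desc, Function.iterate_zero, id_eq, add_zero, Set.mem_ofPred_eq,
    Set.mem_singleton_iff]
  exact ⟨fun h => h.1, fun h => by simp [h]⟩

lemma Desc_succ (r : ℕ) (v : V) : T.Desc (r + 1) v = ⋃ u ∈ T.children v, T.Desc r u := by
  ext w
  simp only [Desc, children, Set.mem_iUnion, Set.mem_ofPred_eq, exists_prop]
  rw [Function.iterate_succ_apply']
  constructor
  · rintro ⟨h, hd⟩
    have h1 := T.depth_le_depth_iterate_add r w
    have h2 : T.parent^[r] w ≠ T.root := fun h0 => by
      rw [h0, T.depth_root] at h1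
      omega
    have h3 := T.depth_eq_depth_parent_add_one h2
    rw [h] at h3
    exact ⟨_, ⟨h2, h⟩, rfl, by omega⟩
  · rintro ⟨u, ⟨hu, rfl⟩, rfl, hd⟩
    have := T.depth_eq_depth_parent_add_one hu
    exact ⟨rfl, by omega⟩

lemma dgf_nonneg {b : ℝ} (hb0 : 0 ≤ b) (v : V) : 0 ≤ T.dgf b v :=
  tsum_nonneg fun r => by positivity

/-- Coordinate weights after averaging a Hamming-Lipschitz function over all the levels
below `k`. -/
noncomputable def levelWeight (b : ℝ) (k : ℕ) (v : V) : ℝ :=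
  if T.depth v < k then 1 else if T.depth v = k then T.dgf b v else 0

lemma levelWeight_nonneg {b : ℝ} (hb0 : 0 ≤ b) (k : ℕ) (v : V) : 0 ≤ T.levelWeight b k v := by
  unfold levelWeight
  split_ifs
  exacts [zero_le_one, T.dgf_nonneg hb0 v, le_rfl]

variable [Fintype V]

lemma depth_lt_card (v : V) : T.depth v < Fintype.card V := by
  have hinj : Function.Injective fun i : Fin (T.depth v + 1) => T.parent^[i] v := fun i j h => by
    have h := congrArg T.depth h
    dsimp only at h
    rw [T.depth_iterate (Nat.lt_succ_iff.1 i.2), T.depth_iterate (Nat.lt_succ_iff.1 j.2)] at h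
    ext
    omega
  simpa using Fintype.card_le_of_injective _ hinj

open Classical in
lemma card_Desc_succ (r : ℕ) (v : V) : Nat.card (T.Desc (r + 1) v) =
    ∑ u with u ≠ T.root ∧ T.parent u = v, Nat.card (T.Desc r u) := by
  have h : T.Desc (r + 1) v = ((({u | u ≠ T.root ∧ T.parent u = v} : Finset V).biUnion
      fun u => (T.Desc r u).toFinset : Finset V) : Set V) := by
    rw [Desc_succ]
    simp [children]
  rw [h, Nat.card_coe_set_eq, Set.ncard_coe_finset, Finset.card_biUnion]
  · exact Finset.sum_congr rfl fun u _ => by rw [Set.toFinset_card, Nat.card_eq_fintype_card]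
  · intro u _ u' _ huu'
    rw [Function.onFun, Set.disjoint_toFinset, Set.disjoint_left]
    exact fun w hw hw' => huu' (hw.1.symm.trans hw'.1)

lemma summable_dgf {b : ℝ} (hb0 : 0 ≤ b) (hb1 : b < 1) (v : V) :
    Summable fun r : ℕ => (Nat.card (T.Desc r v) : ℝ) * b ^ r := by
  refine .of_nonneg_of_le (fun r => by positivity) (fun r => ?_)
    ((summable_geometric_of_lt_one hb0 hb1).mul_left (Nat.card V : ℝ))
  exact mul_le_mul_of_nonneg_right (by exact_mod_cast Finite.card_subtype_le _) (by positivity)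

open Classical in
/-- The recursion satisfied by the descendant generating function. -/
lemma dgf_eq {b : ℝ} (hb0 : 0 ≤ b) (hb1 : b < 1) (v : V) :
    T.dgf b v = 1 + b * ∑ u with u ≠ T.root ∧ T.parent u = v, T.dgf b u := by
  simp only [dgf]
  rw [(T.summable_dgf hb0 hb1 v).tsum_eq_zero_add,
    ← Summable.tsum_finsetSum fun u _ => T.summable_dgf hb0 hb1 u, ← tsum_mul_left]
  congr 1
  · simp [Desc_zero]
  · refine tsum_congr fun r => ?_
    rw [card_Desc_succ, Finset.mul_sum, Nat.cast_sum, Finset.sum_mul]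
    exact Finset.sum_congr rfl fun u _ => by ring

open Classical in
lemma levelWeight_eq {b : ℝ} (hb0 : 0 ≤ b) (hb1 : b < 1) (k : ℕ) (v : V) :
    T.levelWeight b k v = (if T.depth v = k + 1 then 0 else T.levelWeight b (k + 1) v) +
      b * ∑ u with T.depth u = k + 1 ∧ T.parent u = v, T.levelWeight b (k + 1) u := by
  rcases eq_or_ne (T.depth v) k with hk | hk
  · have hset : ∀ u, (T.depth u = k + 1 ∧ T.parent u = v) ↔ (u ≠ T.root ∧ T.parent u = v) := by
      refine fun u => and_congr_left fun hu => ⟨fun h h0 => ?_, fun h => ?_⟩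
      · rw [h0, T.depth_root] at h
        omega
      · rw [T.depth_eq_depth_parent_add_one h, hu, hk]
    have hsum : ∀ u ∈ ({u | u ≠ T.root ∧ T.parent u = v} : Finset V),
        T.levelWeight b (k + 1) u = T.dgf b u := fun u hu => by
      have h := ((hset u).2 (by simpa using hu)).1
      simp [levelWeight, h]
    rw [Finset.filter_congr fun u _ => hset u, Finset.sum_congr rfl hsum]
    simpa [levelWeight, hk] using T.dgf_eq hb0 hb1 v
  · have hempty : ({u | T.depth u = k + 1 ∧ T.parent u = v} : Finset V) = ∅ := by
      refine Finset.filter_eq_empty_iff.2 fun u _ ⟨h, hu⟩ => hk ?_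
      have := T.depth_eq_depth_parent_add_one (v := u) fun h0 => by
        rw [h0, T.depth_root] at h
        omega
      rw [hu] at this
      omega
    rw [hempty]
    simp only [levelWeight, Finset.sum_empty, mul_zero, add_zero]
    split_ifs <;> first | rfl | omega

end Combinatorics

section Kernels

variable {V H : Type*} [Fintype V] (T : ParentTree V)

/-- The one-level transition of the broadcast model. -/
noncomputable def levelStep [MeasurableSpace H] (q : V → Kernel H H) (k : ℕ) (x : V → H) (v : V) :
    Measure H :=
  if T.depth v = k + 1 then q v (x (T.parent v)) else Measure.dirac (x v)

instance [MeasurableSpace H] (q : V → Kernel H H) [∀ v, IsMarkovKernel (q v)] (k : ℕ) (x : V → H)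
    (v : V) : IsProbabilityMeasure (T.levelStep q k x v) := by
  unfold levelStep
  split_ifs <;> infer_instance

lemma measurable_pi_levelStep [MeasurableSpace H] (q : V → Kernel H H) [∀ v, IsMarkovKernel (q v)]
    (k : ℕ) : Measurable fun x => Measure.pi (T.levelStep q k x) := by
  refine Measurable.measure_of_isPiSystem_of_isProbabilityMeasure generateFrom_pi.symm
    isPiSystem_pi ?_
  rintro _ ⟨s, hs, rfl⟩
  simp only [Measure.pi_pi]
  refine Finset.measurable_prod _ fun v _ => ?_
  have hsv : MeasurableSet (s v) := hs v trivial
  unfold levelStep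
  split_ifs
  · exact (Kernel.measurable_coe (q v) hsv).comp (measurable_pi_apply _)
  · exact (Measure.measurable_coe hsv).comp (Measure.measurable_dirac.comp (measurable_pi_apply v))

/-- The one-level transition as a Markov kernel on configurations. -/
noncomputable def levelKernel [MeasurableSpace H] (q : V → Kernel H H) [∀ v, IsMarkovKernel (q v)]
    (k : ℕ) : Kernel (V → H) (V → H) :=
  ⟨fun x => Measure.pi (T.levelStep q k x), T.measurable_pi_levelStep q k⟩

lemma levelMeasure_succ [MeasurableSpace H] (m : Measure H) (q : V → Kernel H H)
    [∀ v, IsMarkovKernel (q v)] (k : ℕ) : T.levelMeasure m q (k + 1) =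
      (T.levelKernel q k ∘ₖ Kernel.const Unit (T.levelMeasure m q k)) () := by
  rw [Kernel.comp_apply, Kernel.const_apply]
  rfl

instance [MeasurableSpace H] (m : Measure H) [IsProbabilityMeasure m] (q : V → Kernel H H)
    [∀ v, IsMarkovKernel (q v)] (k : ℕ) : IsProbabilityMeasure (T.levelMeasure m q k) := by
  induction k with
  | zero => exact Measure.isProbabilityMeasure_map (by fun_prop)
  | succ k ih =>
    exact isProbabilityMeasure_bind (T.measurable_pi_levelStep q k).aemeasurable
      (ae_of_all _ fun _ => inferInstance)

lemma integrable_integral_levelStep [MeasurableSpace H] (m : Measure H) (q : V → Kernel H H)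
    [∀ v, IsMarkovKernel (q v)] (k : ℕ) {F : (V → H) → ℝ}
    (hF : Integrable F (T.levelMeasure m q (k + 1))) :
    Integrable (fun x => ∫ y, F y ∂Measure.pi (T.levelStep q k x)) (T.levelMeasure m q k) := by
  rw [levelMeasure_succ] at hF
  exact hF.integral_comp

lemma integral_levelMeasure_succ [MeasurableSpace H] (m : Measure H) (q : V → Kernel H H)
    [∀ v, IsMarkovKernel (q v)] (k : ℕ) {F : (V → H) → ℝ}
    (hF : Integrable F (T.levelMeasure m q (k + 1))) :
    ∫ x, F x ∂T.levelMeasure m q (k + 1) =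
      ∫ x, ∫ y, F y ∂Measure.pi (T.levelStep q k x) ∂T.levelMeasure m q k := by
  rw [levelMeasure_succ] at hF ⊢
  exact Kernel.integral_comp hF

open Classical in
lemma sum_levelWeight_succ {b : ℝ} (hb0 : 0 ≤ b) (hb1 : b < 1) (k : ℕ) (d : V → ℝ) :
    ∑ v, T.levelWeight b (k + 1) v * (if T.depth v = k + 1 then b * d (T.parent v) else d v) =
      ∑ v, T.levelWeight b k v * d v := by
  have h : ∀ v, T.levelWeight b k v * d v =
      (if T.depth v = k + 1 then 0 else T.levelWeight b (k + 1) v) * d v +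
        ∑ u, if T.parent u = v then
          (if T.depth u = k + 1 then T.levelWeight b (k + 1) u * (b * d v) else 0) else 0 :=
    fun v => by
      rw [T.levelWeight_eq hb0 hb1, add_mul, Finset.sum_filter, Finset.mul_sum, Finset.sum_mul]
      congr 1
      refine Finset.sum_congr rfl fun u _ => ?_
      by_cases h₁ : T.parent u = v <;> by_cases h₂ : T.depth u = k + 1 <;> simp [h₁, h₂]
      ring
  simp only [h]
  rw [Finset.sum_add_distrib, Finset.sum_comm (f := fun v u => _), ← Finset.sum_add_distrib]
  refine Finset.sum_congr rfl fun v _ => ?_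
  simp only [Finset.sum_ite_eq, Finset.mem_univ, if_true]
  split_ifs <;> simp

variable [MetricSpace H] [TopologicalSpace.SeparableSpace H] [MeasurableSpace H] [BorelSpace H]

lemma weightedLip_integral_levelStep (hH : ∀ a b : H, dist a b ≤ 1) {b : ℝ} (hb0 : 0 ≤ b)
    (hb1 : b < 1) (q : V → Kernel H H) [∀ v, IsMarkovKernel (q v)]
    (hq : ∀ v, v ≠ T.root → ∀ x y : H, transportCost dist (q v x) (q v y) ≤ b * dist x y)
    (k : ℕ) {g : (V → H) → ℝ} (hg : WeightedLip (T.levelWeight b (k + 1)) g) :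
    WeightedLip (T.levelWeight b k) fun x => ∫ y, g y ∂Measure.pi (T.levelStep q k x) := by
  intro x y
  have hw := T.levelWeight_nonneg hb0 (k + 1)
  have hε : ∀ ε > 0, |∫ z, g z ∂Measure.pi (T.levelStep q k x) -
      ∫ z, g z ∂Measure.pi (T.levelStep q k y)| ≤
        ∑ v, T.levelWeight b k v * dist (x v) (y v) + (∑ v, T.levelWeight b (k + 1) v) * ε := by
    intro ε hε
    have hγ : ∀ v, ∃ γ : Measure (H × H), IsProbabilityMeasure γ ∧
        γ.map Prod.fst = T.levelStep q k x v ∧ γ.map Prod.snd = T.levelStep q k y v ∧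
        ∫ p, dist p.1 p.2 ∂γ ≤ (if T.depth v = k + 1 then
          b * dist (x (T.parent v)) (y (T.parent v)) else dist (x v) (y v)) + ε := fun v => by
      have := UniformSpace.secondCountable_of_separable H
      by_cases h : T.depth v = k + 1
      · have hv : v ≠ T.root := fun h0 => by
          rw [h0, T.depth_root] at h
          omega
        simp only [levelStep, h, if_true]
        exact exists_coupling_of_transportCost_le _ _ (hq v hv _ _) hε
      · simp only [levelStep, h, if_false]
        refine ⟨Measure.dirac (x v, y v), inferInstance, ?_, ?_, ?_⟩
        · rw [Measure.map_dirac' measurable_fst]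
        · rw [Measure.map_dirac' measurable_snd]
        · rw [integral_dirac]
          exact le_add_of_nonneg_right hε.le
    choose γ hγp h₁ h₂ hγ using hγ
    refine (abs_integral_pi_sub_le_of_coupling hH _ _ hg hw γ h₁ h₂ hγ).trans (le_of_eq ?_)
    rw [← T.sum_levelWeight_succ hb0 hb1 k fun v => dist (x v) (y v), Finset.sum_mul,
      ← Finset.sum_add_distrib]
    exact Finset.sum_congr rfl fun v _ => mul_add _ _ _
  refine le_of_forall_pos_le_add fun ε hpos => ?_
  have hS : 0 ≤ ∑ v, T.levelWeight b (k + 1) v := Finset.sum_nonneg fun v _ => hw v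
  refine (hε (ε / (∑ v, T.levelWeight b (k + 1) v + 1)) (by positivity)).trans ?_
  gcongr
  rw [mul_div_assoc', div_le_iff₀ (by positivity)]
  nlinarith

lemma integral_exp_levelMeasure_le (hH : ∀ a b : H, dist a b ≤ 1) {b : ℝ} (hb0 : 0 ≤ b)
    (hb1 : b < 1) (m : Measure H) [IsProbabilityMeasure m] (q : V → Kernel H H)
    [∀ v, IsMarkovKernel (q v)]
    (hq : ∀ v, v ≠ T.root → ∀ x y : H, transportCost dist (q v x) (q v y) ≤ b * dist x y)
    (t : ℝ) (k : ℕ) {g : (V → H) → ℝ} (hg : WeightedLip (T.levelWeight b k) g) :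
    ∫ x, Real.exp (t * g x) ∂T.levelMeasure m q k ≤
      Real.exp (t * ∫ x, g x ∂T.levelMeasure m q k +
        t ^ 2 * (∑ v with T.depth v ≤ k, T.dgf b v ^ 2) / 8) := by
  induction k generalizing g with
  | zero =>
    have hconst : Measurable fun (h : H) (_ : V) => h := by fun_prop
    have hroot : ({v | T.depth v ≤ 0} : Finset V) = {T.root} := by
      ext v
      simp [T.depth_eq_zero_iff]
    rw [levelMeasure, integral_map hconst.aemeasurable
        (hg.measurable.const_mul t).exp.aestronglyMeasurable,
      integral_map hconst.aemeasurable hg.measurable.aestronglyMeasurable, hroot,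
      Finset.sum_singleton]
    refine integral_exp_le_of_abs_sub_le m (hg.measurable.comp hconst) (fun h h' => ?_) t
    refine (hg _ _).trans ?_
    rw [Finset.sum_eq_single T.root]
    · simpa [levelWeight, T.depth_root] using
        mul_le_of_le_one_right (T.dgf_nonneg hb0 T.root) (hH h h')
    · intro v _ hv
      simp [levelWeight, mt T.depth_eq_zero_iff.1 hv]
    · simp
  | succ k ih =>
    set G : (V → H) → ℝ := fun x => ∫ y, g y ∂Measure.pi (T.levelStep q k x)
    have hG : WeightedLip (T.levelWeight b k) G :=
      T.weightedLip_integral_levelStep hH hb0 hb1 q hq k hg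
    have hsq : (∑ v with T.depth v ≤ k + 1, T.dgf b v ^ 2) =
        (∑ v with T.depth v ≤ k, T.dgf b v ^ 2) +
          ∑ v, if T.depth v = k + 1 then T.levelWeight b (k + 1) v ^ 2 else 0 := by
      rw [Finset.sum_filter, Finset.sum_filter, ← Finset.sum_add_distrib]
      refine Finset.sum_congr rfl fun v _ => ?_
      rcases lt_trichotomy (T.depth v) (k + 1) with h | h | h
      · simp [h.le, h.ne, Nat.lt_succ_iff.1 h]
      · simp [h, levelWeight]
      · simp [h.not_ge, h.ne', show ¬ T.depth v ≤ k by omega]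
    have hstep : ∀ x, ∫ y, Real.exp (t * g y) ∂Measure.pi (T.levelStep q k x) ≤
        Real.exp (t ^ 2 * (∑ v, if T.depth v = k + 1 then T.levelWeight b (k + 1) v ^ 2 else 0) / 8)
          * Real.exp (t * G x) := fun x => by
      rw [← Real.exp_add, add_comm (_ / 8)]
      exact integral_exp_pi_le_of_dirac hH t (fun v => T.depth v = k + 1) _ x
        (fun v hv => by simp [levelStep, hv]) (T.levelWeight_nonneg hb0 (k + 1)) hg
    have hexp : Integrable (fun x => Real.exp (t * g x)) (T.levelMeasure m q (k + 1)) :=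
      hg.integrable_exp hH t _ measurable_id
    rw [T.integral_levelMeasure_succ m q k hexp,
      T.integral_levelMeasure_succ m q k (F := g) (hg.integrable hH _ measurable_id)]
    refine (integral_mono (T.integrable_integral_levelStep m q k hexp)
      ((hG.integrable_exp hH t _ measurable_id).const_mul _) hstep).trans ?_
    rw [integral_const_mul]
    refine (mul_le_mul_of_nonneg_left (ih hG) (Real.exp_nonneg _)).trans (le_of_eq ?_)
    rw [← Real.exp_add, hsq]
    congr 1
    ring

end Kernels

end ParentTree

/-- **Theorem (main concentration inequality).** Let `T` be a finite rooted tree with `n`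
vertices, `H` a Polish metric space of diameter at most `1`, `b ∈ [0,1)`, and `ν` a
`b`-Lipschitz `H`-valued Markov measure indexed by `T`. Then for every `f : H^V → ℝ`
which is 1-Lipschitz for the normalized Hamming metric and has `∫ f dν = 0`, and every
`λ ∈ ℝ`, one has `∫ e^{nλf} dν ≤ e^{λ²Δ²/8}`. -/
theorem markov_exp_moment_bound
    {V : Type} [Fintype V] (T : ParentTree V)
    {H : Type} [MetricSpace H] [TopologicalSpace.SeparableSpace H] [CompleteSpace H]
    [MeasurableSpace H] [BorelSpace H]
    (hdiam : EMetric.diam (Set.univ : Set H) ≤ 1)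
    {b : ℝ} (hb0 : 0 ≤ b) (hb1 : b < 1)
    (ν : MeasureTheory.Measure (V → H)) (hν : T.IsLipMarkov b ν)
    (f : (V → H) → ℝ) (hf : ∀ x y : V → H, |f x - f y| ≤ nhdist x y)
    (hf0 : ∫ x, f x ∂ν = 0) (lam : ℝ) :
    ∫ x, Real.exp ((Fintype.card V : ℝ) * lam * f x) ∂ν ≤
      Real.exp (lam ^ 2 * (T.Delta b) ^ 2 / 8) := by
  classical
  obtain ⟨m, q, hm, hq, hlip, rfl⟩ := hν
  have hH : ∀ x y : H, dist x y ≤ 1 := fun x y => by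
    rw [← ENNReal.ofReal_le_ofReal_iff zero_le_one, ← edist_dist, ENNReal.ofReal_one]
    exact (Metric.edist_le_ediam_of_mem (Set.mem_univ x) (Set.mem_univ y)).trans hdiam
  have hcard : (0 : ℝ) < Fintype.card V := by exact_mod_cast Fintype.card_pos_iff.2 ⟨T.root⟩
  have hg : WeightedLip (T.levelWeight b (Fintype.card V))
      fun x => (Fintype.card V : ℝ) * f x := fun x y => by
    rw [← mul_sub, abs_mul, abs_of_pos hcard]
    refine (mul_le_mul_of_nonneg_left (hf x y) hcard.le).trans (le_of_eq ?_)
    rw [nhdist, mul_inv_cancel_left₀ hcard.ne']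
    simp [ParentTree.levelWeight, T.depth_lt_card]
  have h := T.integral_exp_levelMeasure_le hH hb0 hb1 m q hlip lam (Fintype.card V) hg
  rw [integral_const_mul, hf0, Finset.filter_true_of_mem fun v _ => (T.depth_lt_card v).le] at h
  rw [ParentTree.Delta, Real.sq_sqrt (Finset.sum_nonneg fun v _ => sq_nonneg _)]
  simpa [mul_assoc, mul_left_comm] using h
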